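/- arXiv:2407.04847 — 2 statements merged into one kernel-verified Lean document; each statement's English description precedes it below -/
import Mathlib

section
/- Let $q, \psi$ be as in the Darboux factorization with $\psi > 0$ solving $-\psi'' + q\psi = \lambda\psi$, and let $f, g$ be solutions of $-y'' + qy = zy$. Then the Wronskian of the Darboux-transformed solutions satisfies $W(A_\psi f, A_\psi g)(x) = (z - \lambda)\, W(f,g)(x)$ for all $x$, where $W(f,g) = fg' - f'g$ and $A_\psi h = -h' + (\psi'/\psi)h$. -/
open MeasureTheory Filter Topology Set

theorem ContDiffOn.differentiableAt_deriv_of_isOpen {F : Type*} [NormedAddCommGroup F]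
    [NormedSpace ℝ F] {u : ℝ → F} {s : Set ℝ} (hu : ContDiffOn ℝ 2 u s) (hs : IsOpen s)
    {x : ℝ} (hx : x ∈ s) : DifferentiableAt ℝ (deriv u) x :=
  ((hu.deriv_of_isOpen (m := 1) hs (by norm_num)).differentiableOn one_ne_zero).differentiableAt
    (hs.mem_nhds hx)

/-- The logarithmic derivative `ψ' / ψ` of a solution satisfies the Riccati equation. -/
theorem hasDerivAt_deriv_div_self_of_schrodinger {ψ : ℝ → ℝ} {x q lam : ℝ}
    (hψ : DifferentiableAt ℝ ψ x) (hψ' : DifferentiableAt ℝ (deriv ψ) x) (hx : ψ x ≠ 0)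
    (heq : -(deriv (deriv ψ) x) + q * ψ x = lam * ψ x) :
    HasDerivAt (fun y => deriv ψ y / ψ y) (q - lam - (deriv ψ x / ψ x) ^ 2) x := by
  refine (hψ'.hasDerivAt.fun_div hψ.hasDerivAt hx).congr_deriv ?_
  have h : deriv (deriv ψ) x = (q - lam) * ψ x := by linear_combination -heq
  rw [h]
  field_simp

/-- If `φ` satisfies the Riccati equation at `x`, the Darboux transform `h = -u' + φ u` of a
solution `u` satisfies `h' = (z - lam) u - φ h` at `x`. -/
theorem hasDerivAt_darboux {φ : ℝ → ℝ} {u : ℝ → ℂ} {x q lam : ℝ} {z : ℂ}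
    (hφ : HasDerivAt φ (q - lam - φ x ^ 2) x) (hu : DifferentiableAt ℝ u x)
    (hu' : DifferentiableAt ℝ (deriv u) x)
    (heq : -(deriv (deriv u) x) + (q : ℂ) * u x = z * u x) :
    HasDerivAt (fun y => -(deriv u y) + (φ y : ℂ) * u y)
      ((z - lam) * u x - φ x * (-(deriv u x) + (φ x : ℂ) * u x)) x := by
  refine (hu'.hasDerivAt.fun_neg.fun_add (hφ.ofReal_comp.fun_mul hu.hasDerivAt)).congr_deriv ?_
  push_cast
  linear_combination heq

theorem stmt5 (a b lam : ℝ) (z : ℂ) (q ψ : ℝ → ℝ) (f g : ℝ → ℂ)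
    (hψ : ContDiffOn ℝ (⊤ : ℕ∞) ψ (Ioo a b))
    (hψpos : ∀ x ∈ Ioo a b, 0 < ψ x)
    (hf : ContDiffOn ℝ (⊤ : ℕ∞) f (Ioo a b))
    (hg : ContDiffOn ℝ (⊤ : ℕ∞) g (Ioo a b))
    (hψeq : ∀ x ∈ Ioo a b, -(deriv (deriv ψ) x) + q x * ψ x = lam * ψ x)
    (hfeq : ∀ x ∈ Ioo a b, -(deriv (deriv f) x) + (q x : ℂ) * f x = z * f x)
    (hgeq : ∀ x ∈ Ioo a b, -(deriv (deriv g) x) + (q x : ℂ) * g x = z * g x) :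
    ∀ x ∈ Ioo a b,
      (-(deriv f x) + ((deriv ψ x / ψ x : ℝ) : ℂ) * f x)
          * deriv (fun y => -(deriv g y) + ((deriv ψ y / ψ y : ℝ) : ℂ) * g y) x
        - deriv (fun y => -(deriv f y) + ((deriv ψ y / ψ y : ℝ) : ℂ) * f y) x
          * (-(deriv g x) + ((deriv ψ x / ψ x : ℝ) : ℂ) * g x)
      = (z - (lam : ℂ)) * (f x * deriv g x - deriv f x * g x) := by
  intro x hx
  have hx' : Ioo a b ∈ 𝓝 x := isOpen_Ioo.mem_nhds hx
  have h2 : (2 : WithTop ℕ∞) ≤ ((⊤ : ℕ∞) : WithTop ℕ∞) :=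
    WithTop.coe_le_coe.2 (le_top : (2 : ℕ∞) ≤ ⊤)
  have hφ := hasDerivAt_deriv_div_self_of_schrodinger
    (((hψ.of_le h2).differentiableOn two_ne_zero).differentiableAt hx')
    ((hψ.of_le h2).differentiableAt_deriv_of_isOpen isOpen_Ioo hx) (hψpos x hx).ne' (hψeq x hx)
  have hAf := hasDerivAt_darboux hφ
    (((hf.of_le h2).differentiableOn two_ne_zero).differentiableAt hx')
    ((hf.of_le h2).differentiableAt_deriv_of_isOpen isOpen_Ioo hx) (hfeq x hx)
  have hAg := hasDerivAt_darboux hφ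
    (((hg.of_le h2).differentiableOn two_ne_zero).differentiableAt hx')
    ((hg.of_le h2).differentiableAt_deriv_of_isOpen isOpen_Ioo hx) (hgeq x hx)
  rw [hAf.deriv, hAg.deriv]
  ring
end

section
/- In the setting of the Lagrange identity above, assume additionally that $\theta(z_2,\cdot)$ and $\varphi(z_1,\cdot)$ each have constant sign on some interval $(a, a+\varepsilon)$ (nonoscillatory at $a$). Then the limit $L = \lim_{x\to a^+} W(\theta(z_2,\cdot), \varphi(z_1,\cdot))(x)$ exists in $\mathbb{R}\cup\{\pm\infty\}$, and $L$ is finite if and only if $\int_a^c |\theta(z_2,t)\varphi(z_1,t)| r(t)\,dt < \infty$. -/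
open MeasureTheory Filter Topology Set

/-- A function with nonnegative derivative `h` near the left endpoint has a limit in `EReal` there,
which is finite exactly when `h` is integrable near that endpoint. -/
theorem exists_tendsto_ereal_of_deriv_nonneg {a b m : ℝ} (ham : a < m) (hmb : m < b)
    {V h : ℝ → ℝ} (hV : ∀ x ∈ Ioo a b, HasDerivAt V (h x) x) (hh : ∀ x ∈ Ioo a b, 0 ≤ h x) :
    ∃ L : EReal, Tendsto (fun x => ((V x : ℝ) : EReal)) (𝓝[>] a) (𝓝 L) ∧
      ((L ≠ ⊤ ∧ L ≠ ⊥) ↔ IntegrableOn h (Ioc a m)) := by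
  have hmono : MonotoneOn V (Ioo a b) := by
    refine monotoneOn_of_deriv_nonneg (convex_Ioo a b)
      (fun x hx => (hV x hx).continuousAt.continuousWithinAt) ?_ ?_ <;> rw [interior_Ioo]
    · exact fun x hx => (hV x hx).differentiableAt.differentiableWithinAt
    · intro x hx
      rw [(hV x hx).deriv]
      exact hh x hx
  have hlim : Tendsto (fun x => ((V x : ℝ) : EReal)) (𝓝[>] a)
      (𝓝 (sInf ((fun x => ((V x : ℝ) : EReal)) '' Ioo a b))) := by
    have hmono' : MonotoneOn (fun x => ((V x : ℝ) : EReal)) (Ioo a b) :=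
      fun x hx y hy hxy => EReal.coe_le_coe_iff.2 (hmono hx hy hxy)
    exact hmono'.tendsto_nhdsWithin_Ioo_right (nonempty_Ioo.2 (ham.trans hmb)) (OrderBot.bddBelow _)
  have hnear : ∀ᶠ x in 𝓝[>] a, x ∈ Ioo a m := Ioo_mem_nhdsGT ham
  refine ⟨_, hlim, ?_⟩
  generalize sInf ((fun x => ((V x : ℝ) : EReal)) '' Ioo a b) = L at hlim
  constructor
  · rintro ⟨htop, hbot⟩
    lift L to ℝ using ⟨htop, hbot⟩
    have hlim' : Tendsto V (𝓝[>] a) (𝓝 L) := EReal.tendsto_coe.1 hlim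
    have hcont : ContinuousOn (Function.update V a L) (Icc a m) := by
      rw [continuousOn_update_iff]
      refine ⟨fun x hx => ?_, fun _ => hlim'.mono_left (nhdsWithin_mono _ ?_)⟩
      · exact (hV x ⟨lt_of_le_of_ne hx.1.1 (Ne.symm hx.2), hx.1.2.trans_lt hmb⟩).continuousAt
          |>.continuousWithinAt
      · exact fun x hx => lt_of_le_of_ne hx.1.1 (Ne.symm hx.2)
    refine intervalIntegral.integrableOn_deriv_of_nonneg hcont (fun x hx => ?_)
      (fun x hx => hh x ⟨hx.1, hx.2.trans hmb⟩)
    refine (hV x ⟨hx.1, hx.2.trans hmb⟩).congr_of_eventuallyEq ?_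
    filter_upwards [isOpen_ne.mem_nhds hx.1.ne'] with y hy
    exact Function.update_of_ne hy _ _
  · intro hint
    have hlower : ∀ x ∈ Ioo a m, V m - ∫ t in Ioc a m, h t ≤ V x := by
      intro x hx
      have hsub : Ioc x m ⊆ Ioc a m := Ioc_subset_Ioc_left hx.1.le
      have hFTC : ∫ t in x..m, h t = V m - V x := by
        refine intervalIntegral.integral_eq_sub_of_hasDerivAt (fun t ht => ?_)
          ((intervalIntegrable_iff_integrableOn_Ioc_of_le hx.2.le).2 (hint.mono_set hsub))
        rw [uIcc_of_le hx.2.le] at ht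
        exact hV t ⟨hx.1.trans_le ht.1, ht.2.trans_lt hmb⟩
      rw [intervalIntegral.integral_of_le hx.2.le] at hFTC
      have hle : ∫ t in Ioc x m, h t ≤ ∫ t in Ioc a m, h t :=
        setIntegral_mono_set hint
          ((ae_restrict_iff' measurableSet_Ioc).2
            (ae_of_all _ fun t ht => hh t ⟨ht.1, ht.2.trans_lt hmb⟩))
          (ae_of_all _ hsub)
      linarith
    have hge : ((V m - ∫ t in Ioc a m, h t : ℝ) : EReal) ≤ L :=
      ge_of_tendsto hlim (hnear.mono fun x hx => EReal.coe_le_coe_iff.2 (hlower x hx))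
    have hle : L ≤ ((V m : ℝ) : EReal) :=
      le_of_tendsto hlim (hnear.mono fun x hx => EReal.coe_le_coe_iff.2
        (hmono ⟨hx.1, hx.2.trans hmb⟩ ⟨ham, hmb⟩ hx.2.le))
    exact ⟨(hle.trans_lt (EReal.coe_lt_top _)).ne, ((EReal.bot_lt_coe _).trans_le hge).ne'⟩

/-- A function whose derivative near the left endpoint is a nonzero multiple of a nonnegative
function `k` has a limit in `EReal` there, which is finite exactly when `k` is integrable near that
endpoint. -/
theorem exists_tendsto_ereal_of_deriv_eq_const_mul {a b m κ : ℝ} (ham : a < m) (hmb : m < b)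
    (hκ : κ ≠ 0) {V k : ℝ → ℝ} (hV : ∀ x ∈ Ioo a b, HasDerivAt V (κ * k x) x)
    (hk : ∀ x ∈ Ioo a b, 0 ≤ k x) :
    ∃ L : EReal, Tendsto (fun x => ((V x : ℝ) : EReal)) (𝓝[>] a) (𝓝 L) ∧
      ((L ≠ ⊤ ∧ L ≠ ⊥) ↔ IntegrableOn k (Ioc a m)) := by
  rcases lt_or_gt_of_ne hκ with hneg | hpos
  · obtain ⟨L, hL, hiff⟩ := exists_tendsto_ereal_of_deriv_nonneg ham hmb (V := fun x => -V x)
      (h := fun x => -κ * k x) (fun x hx => by simpa [neg_mul] using (hV x hx).fun_neg)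
      (fun x hx => mul_nonneg (neg_nonneg.2 hneg.le) (hk x hx))
    refine ⟨-L, ?_, ?_⟩
    · simpa [Function.comp_def] using (continuous_neg.tendsto L).comp hL
    · rw [IntegrableOn, integrable_const_mul_iff (neg_ne_zero.2 hκ).isUnit] at hiff
      rw [IntegrableOn, ← hiff, Ne, Ne, EReal.neg_eq_top_iff, EReal.neg_eq_bot_iff, and_comm]
  · obtain ⟨L, hL, hiff⟩ := exists_tendsto_ereal_of_deriv_nonneg ham hmb hV
      (fun x hx => mul_nonneg hpos.le (hk x hx))
    rw [IntegrableOn, integrable_const_mul_iff hκ.isUnit] at hiff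
    exact ⟨L, hL, hiff⟩

theorem stmt15 (a c z1 z2 : ℝ) (hac : a < c) (hz : z1 ≠ z2)
    (f g r W : ℝ → ℝ)
    (hr : ∀ x ∈ Ioo a c, 0 < r x)
    (hW : ∀ x ∈ Ioo a c, HasDerivAt W ((z2 - z1) * f x * g x * r x) x)
    (hfsign : ∃ ε > 0, a + ε ≤ c ∧
      ((∀ x ∈ Ioo a (a + ε), 0 < f x) ∨ (∀ x ∈ Ioo a (a + ε), f x < 0)))
    (hgsign : ∃ ε > 0, a + ε ≤ c ∧
      ((∀ x ∈ Ioo a (a + ε), 0 < g x) ∨ (∀ x ∈ Ioo a (a + ε), g x < 0)))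
    (hloc : ∀ x ∈ Ioo a c, IntegrableOn (fun t => f t * g t * r t) (Ioo x c)) :
    ∃ L : EReal,
      Tendsto (fun x => ((W x : ℝ) : EReal)) (𝓝[>] a) (𝓝 L) ∧
      ((L ≠ ⊤ ∧ L ≠ ⊥) ↔ IntegrableOn (fun t => |f t * g t| * r t) (Ioo a c)) := by
  obtain ⟨εf, hεf, hεfc, hf⟩ := hfsign
  obtain ⟨εg, hεg, -, hg⟩ := hgsign
  set ε := min εf εg
  have hε0 : 0 < ε := lt_min hεf hεg
  have hεle : ε ≤ εf := min_le_left _ _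
  have hεle' : ε ≤ εg := min_le_right _ _
  have hf' : (∀ x ∈ Ioo a (a + ε), 0 < f x) ∨ (∀ x ∈ Ioo a (a + ε), f x < 0) :=
    hf.imp (fun H x hx => H x ⟨hx.1, by linarith [hx.2]⟩)
      (fun H x hx => H x ⟨hx.1, by linarith [hx.2]⟩)
  have hg' : (∀ x ∈ Ioo a (a + ε), 0 < g x) ∨ (∀ x ∈ Ioo a (a + ε), g x < 0) :=
    hg.imp (fun H x hx => H x ⟨hx.1, by linarith [hx.2]⟩)
      (fun H x hx => H x ⟨hx.1, by linarith [hx.2]⟩)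
  have hIoo : ∀ x ∈ Ioo a (a + ε), x ∈ Ioo a c := fun x hx => ⟨hx.1, by linarith [hx.2]⟩
  obtain ⟨κ, hκ, hκeq⟩ : ∃ κ : ℝ, κ ≠ 0 ∧ ∀ x ∈ Ioo a (a + ε),
      (z2 - z1) * f x * g x * r x = κ * (|f x * g x| * r x) := by
    have hz' : z2 - z1 ≠ 0 := sub_ne_zero.2 hz.symm
    rcases hf' with hf' | hf' <;> rcases hg' with hg' | hg'
    · refine ⟨z2 - z1, hz', fun x hx => ?_⟩
      rw [abs_of_pos (mul_pos (hf' x hx) (hg' x hx))]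
      ring
    · refine ⟨-(z2 - z1), neg_ne_zero.2 hz', fun x hx => ?_⟩
      rw [abs_of_neg (mul_neg_of_pos_of_neg (hf' x hx) (hg' x hx))]
      ring
    · refine ⟨-(z2 - z1), neg_ne_zero.2 hz', fun x hx => ?_⟩
      rw [abs_of_neg (mul_neg_of_neg_of_pos (hf' x hx) (hg' x hx))]
      ring
    · refine ⟨z2 - z1, hz', fun x hx => ?_⟩
      rw [abs_of_pos (mul_pos_of_neg_of_neg (hf' x hx) (hg' x hx))]
      ring
  have ham : a < a + ε / 2 := by linarith
  have hmc : a + ε / 2 < c := by linarith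
  obtain ⟨L, hL, hiff⟩ := exists_tendsto_ereal_of_deriv_eq_const_mul ham
    (show a + ε / 2 < a + ε by linarith) hκ (V := W) (k := fun x => |f x * g x| * r x)
    (fun x hx => hκeq x hx ▸ hW x (hIoo x hx))
    (fun x hx => mul_nonneg (abs_nonneg _) (hr x (hIoo x hx)).le)
  have hright : IntegrableOn (fun t => |f t * g t| * r t) (Ioo (a + ε / 2) c) := by
    have habs : IntegrableOn (fun t => |f t * g t * r t|) (Ioo (a + ε / 2) c) :=
      (hloc _ ⟨ham, hmc⟩).abs
    refine habs.congr_fun (fun t ht => ?_) measurableSet_Ioo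
    simp only [abs_mul, abs_of_pos (hr t ⟨ham.trans ht.1, ht.2⟩)]
  refine ⟨L, hL, hiff.trans ?_⟩
  rw [← Ioc_union_Ioo_eq_Ioo ham.le hmc, integrableOn_union]
  exact ⟨fun h => ⟨h, hright⟩, And.left⟩
end
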